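/- arXiv:1208.4636 — 2 statements merged into one kernel-verified Lean document; each statement's English description precedes it below -/
import Mathlib

section
/- Let l be a totally real number field and let k/l be a Galois extension of number fields with Gal(k/l) isomorphic to the quaternion group Q₈ of order 8. Then the unique intermediate field of k/l of degree 4 over l is totally real. (The intermediate field of degree 4 is unique because Q₈ has a unique subgroup of order 2.) -/
open NumberField

/-- In `Q₈`, the central element `a 2` is the only involution. -/
theorem QuaternionGroup.sq_eq_one_iff (g : QuaternionGroup 2) :
    g ^ 2 = 1 ↔ g = 1 ∨ g = a 2 := by
  revert g
  decide

/-- A group isomorphic to `Q₈` has a unique involution. -/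
theorem exists_orderOf_eq_two_of_mulEquiv_quaternionGroup {G : Type*} [Group G]
    (e : G ≃* QuaternionGroup 2) :
    ∃ z : G, orderOf z = 2 ∧ ∀ g : G, g ^ 2 = 1 → g = 1 ∨ g = z := by
  refine ⟨e.symm (.a 2), ?_, fun g hg ↦ ?_⟩
  · rw [MulEquiv.orderOf_eq, orderOf_eq_prime_iff]
    decide
  · have h : e g ^ 2 = 1 := by rw [← map_pow, hg, map_one]
    rwa [QuaternionGroup.sq_eq_one_iff, map_eq_one_iff e e.injective, ← e.eq_symm_apply] at h

/-- If `z` is the only involution of a group, then a subgroup of order two is generated by `z`. -/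
theorem Subgroup.eq_zpowers_of_card_eq_two {G : Type*} [Group G] {z : G} (hz : orderOf z = 2)
    (huniq : ∀ g : G, g ^ 2 = 1 → g = 1 ∨ g = z) {H : Subgroup G} (hH : Nat.card H = 2) :
    H = zpowers z := by
  have : Finite H := Nat.finite_of_card_ne_zero (by omega)
  refine (Subgroup.eq_of_le_of_card_ge ?_ ?_).symm
  · have hbot : H ≠ ⊥ := fun h ↦ by simp [h] at hH
    obtain ⟨g, hg, hg1⟩ := H.bot_or_exists_ne_one.resolve_left hbot
    have hg2 : g ^ 2 = 1 := by
      have := pow_card_eq_one' (x := (⟨g, hg⟩ : H))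
      rw [hH] at this
      simpa using congrArg Subtype.val this
    rw [zpowers_le, ← (huniq g hg2).resolve_left hg1]
    exact hg
  · rw [hH, Nat.card_zpowers, hz]

/-- If the restriction of a complex embedding of a Galois extension `K/k` to `k` is real, then
complex conjugation induces an automorphism of `K` over `k`. -/
theorem NumberField.ComplexEmbedding.exists_isConj_of_isReal_comp {k K : Type*} [Field k]
    [Field K] [Algebra k K] [IsGalois k K] (φ : K →+* ℂ)
    (h : IsReal (φ.comp (algebraMap k K))) : ∃ σ : K ≃ₐ[k] K, IsConj φ σ := by
  obtain ⟨σ, hσ⟩ := exists_comp_symm_eq_of_comp_eq φ (conjugate φ) (k := k)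
    (RingHom.ext fun x ↦ (RingHom.congr_fun h x).symm)
  exact ⟨σ.symm, hσ.symm⟩

/-- **Lemma (Q₈ extensions of totally real fields).**
Let `l` be a totally real number field and `k/l` Galois with `Gal(k/l) ≅ Q₈`.  Then the
unique intermediate field of `k/l` of degree `4` over `l` is totally real (it is unique
since `Q₈` has a unique subgroup of order `2`). -/
theorem quaternion_extension_degree_four_subfield_totally_real
    (l k : Type*) [Field l] [NumberField l] [Field k] [NumberField k]
    [Algebra l k] [IsGalois l k]
    (hQ8 : Nonempty ((k ≃ₐ[l] k) ≃* QuaternionGroup 2))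
    -- `l` is totally real:
    (hl : ∀ φ : l →+* ℂ, ComplexEmbedding.IsReal φ) :
    -- there is a unique intermediate field of degree 4 over `l`, and it is totally real:
    (∃! M : IntermediateField l k, Module.finrank l M = 4) ∧
    (∀ M : IntermediateField l k, Module.finrank l M = 4 →
      ∀ φ : M →+* ℂ, ComplexEmbedding.IsReal φ) := by
  obtain ⟨e⟩ := hQ8
  obtain ⟨z, hz, huniq⟩ := exists_orderOf_eq_two_of_mulEquiv_quaternionGroup e
  have : FiniteDimensional l k := Module.Finite.of_restrictScalars_finite ℚ l k
  have hrank : Module.finrank l k = 8 := by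
    rw [← IsGalois.card_aut_eq_finrank, Nat.card_congr e.toEquiv, Nat.card_eq_fintype_card,
      QuaternionGroup.card]
  have hfix (M : IntermediateField l k) (hM : Module.finrank l M = 4) :
      M.fixingSubgroup = Subgroup.zpowers z := by
    refine Subgroup.eq_zpowers_of_card_eq_two hz huniq ?_
    have hmul := Module.finrank_mul_finrank l M k
    rw [IsGalois.card_fixingSubgroup_eq_finrank]
    rw [hM, hrank] at hmul
    omega
  refine ⟨⟨IntermediateField.fixedField (Subgroup.zpowers z), ?_, fun M hM ↦ ?_⟩,
    fun M hM φ ↦ ?_⟩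
  · have hmul := Module.finrank_mul_finrank l
      (IntermediateField.fixedField (Subgroup.zpowers z)) k
    rw [IntermediateField.finrank_fixedField_eq_card, Nat.card_zpowers, hz, hrank] at hmul
    omega
  · rw [← hfix M hM, IsGalois.fixedField_fixingSubgroup]
  · obtain ⟨σ, hσ⟩ := ComplexEmbedding.exists_isConj_of_isReal_comp (k := l)
      (ComplexEmbedding.lift k φ) (hl _)
    have hσ2 : σ ^ 2 = 1 := by
      ext x
      simpa [sq] using ComplexEmbedding.isConj_apply_apply hσ x
    have hmem : σ ∈ M.fixingSubgroup := by
      rw [hfix M hM]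
      rcases huniq σ hσ2 with rfl | rfl
      · exact one_mem _
      · exact Subgroup.mem_zpowers _
    ext x
    have hx := hσ.eq (algebraMap M k x)
    rw [(IntermediateField.mem_fixingSubgroup_iff M σ).1 hmem (algebraMap M k x) x.2,
      ComplexEmbedding.lift_algebraMap_apply] at hx
    exact hx.symm
end

section
/- Let G = ℤ/9ℤ ⋊_φ ℤ/3ℤ, where φ sends the generator 1 of ℤ/3ℤ to the automorphism x ↦ 4x of ℤ/9ℤ (so G is the nonabelian group of order 27 containing an element of order 9). Then the automorphism group Aut(G) has order 54. -/
open Multiplicative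

theorem ofAdd_one_pow_zmod_val {n : ℕ} [NeZero n] (x : Multiplicative (ZMod n)) :
    ofAdd (1 : ZMod n) ^ x.toAdd.val = x := by
  rw [← ofAdd_nsmul, nsmul_one, ZMod.natCast_zmod_val, ofAdd_toAdd]

theorem exists_monoidHom_multiplicative_zmod {K : Type*} [Group K] (n : ℕ) (g : K)
    (hg : g ^ n = 1) : ∃ f : Multiplicative (ZMod n) →* K, f (ofAdd 1) = g := by
  let f₀ : ℤ →+ Additive K := zmultiplesHom (Additive K) (Additive.ofMul g)
  have h₀ : f₀ n = 0 := by
    simp only [f₀, zmultiplesHom_apply, natCast_zsmul, ← ofMul_pow, hg, ofMul_one]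
  refine ⟨AddMonoidHom.toMultiplicativeLeft (ZMod.lift n ⟨f₀, h₀⟩), ?_⟩
  have h₁ : ZMod.lift n ⟨f₀, h₀⟩ (1 : ZMod n) = Additive.ofMul g := by
    have := ZMod.lift_coe n ⟨f₀, h₀⟩ 1
    simpa [f₀] using this
  simp [h₁]

theorem eq_one_of_pow_mul_pow_eq_one {K : Type*} [Group K] {g h : K} (hg : g ^ 9 = 1)
    (hg3 : g ^ 3 ≠ 1) (hh : h ^ 3 = 1) (hr : h * g = g ^ 4 * h) {i j : ℕ}
    (hij : g ^ i * h ^ j = 1) : 9 ∣ i ∧ 3 ∣ j := by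
  have hog : orderOf g = 9 := orderOf_eq_prime_pow (p := 3) (n := 1) (by simpa using hg3) hg
  have hconj : SemiconjBy h g (g ^ 4) := hr
  have hgi : g ^ i = (h ^ j)⁻¹ := eq_inv_of_mul_eq_one_left hij
  have hcomm : SemiconjBy h (g ^ i) (g ^ i) := by
    rw [hgi]; exact ((Commute.refl h).pow_right j).inv_right
  have h3i : 3 ∣ i := by
    have h4 : (g ^ 4) ^ i = g ^ i :=
      mul_right_cancel ((hconj.pow_right i).eq.symm.trans hcomm.eq)
    rw [← pow_mul, pow_inj_mod, hog] at h4
    omega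
  have h3j : 3 ∣ j := by
    by_contra hj
    have hcj : Commute (h ^ j) g := by
      rw [eq_inv_of_mul_eq_one_right hij]
      exact ((Commute.refl g).pow_left i).inv_left
    have hcop : (orderOf h).Coprime j :=
      Nat.Coprime.coprime_dvd_left (orderOf_dvd_of_pow_eq_one hh)
        ((Nat.Prime.coprime_iff_not_dvd Nat.prime_three).2 hj)
    obtain ⟨m, hm⟩ := exists_pow_eq_self_of_coprime hcop.symm
    have hc : Commute h g := by rw [← hm]; exact hcj.pow_left m
    have h4 : g ^ 1 = g ^ 4 := by
      rw [pow_one]; exact mul_right_cancel (hc.eq.symm.trans hr)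
    rw [pow_inj_mod, hog] at h4
    omega
  refine ⟨?_, h3j⟩
  obtain ⟨m, rfl⟩ := h3j
  rw [pow_mul, hh, one_pow, mul_one] at hij
  exact hog ▸ orderOf_dvd_of_pow_eq_one hij

section

variable {φ : Multiplicative (ZMod 3) →* MulAut (Multiplicative (ZMod 9))}

theorem semidirectProduct_zmod_eq_pow_mul_pow
    (x : Multiplicative (ZMod 9) ⋊[φ] Multiplicative (ZMod 3)) :
    x = SemidirectProduct.inl (ofAdd 1) ^ x.left.toAdd.val *
      SemidirectProduct.inr (ofAdd 1) ^ x.right.toAdd.val := by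
  rw [← map_pow SemidirectProduct.inl, ← map_pow SemidirectProduct.inr,
    ofAdd_one_pow_zmod_val, ofAdd_one_pow_zmod_val,
    SemidirectProduct.inl_left_mul_inr_right]

theorem exists_monoidHom_of_relations
    (hφ : ∀ x : ZMod 9, φ (ofAdd (1 : ZMod 3)) (ofAdd x) = ofAdd (4 * x))
    {K : Type*} [Group K] {g h : K} (hg : g ^ 9 = 1) (hh : h ^ 3 = 1)
    (hr : h * g = g ^ 4 * h) :
    ∃ f : Multiplicative (ZMod 9) ⋊[φ] Multiplicative (ZMod 3) →* K,
      f (SemidirectProduct.inl (ofAdd 1)) = g ∧ f (SemidirectProduct.inr (ofAdd 1)) = h := by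
  obtain ⟨f₁, h₁⟩ := exists_monoidHom_multiplicative_zmod 9 g hg
  obtain ⟨f₂, h₂⟩ := exists_monoidHom_multiplicative_zmod 3 h hh
  have hgen : ∀ x, f₁ (φ (ofAdd 1) x) = h * f₁ x * h⁻¹ := fun x ↦ by
    have hx : φ (ofAdd 1) x = x ^ 4 := by
      rw [← ofAdd_toAdd x, hφ, ← ofAdd_nsmul, nsmul_eq_mul]; rfl
    have hs : SemiconjBy h g (g ^ 4) := hr
    rw [hx, map_pow, ← ofAdd_one_pow_zmod_val x, map_pow, h₁, (hs.pow_right _).eq,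
      mul_inv_cancel_right, ← pow_mul, ← pow_mul, mul_comm]
  have hpow : ∀ (k : ℕ) x, f₁ (φ (ofAdd 1 ^ k) x) = h ^ k * f₁ x * (h ^ k)⁻¹ := by
    intro k
    induction k with
    | zero => simp
    | succ k ih =>
      intro x
      rw [pow_succ, map_mul, MulAut.mul_apply, ih, hgen, pow_succ]
      group
  refine ⟨SemidirectProduct.lift f₁ f₂ fun z ↦ ?_, by simp [h₁], by simp [h₂]⟩
  refine MonoidHom.ext fun x ↦ ?_
  rw [← ofAdd_one_pow_zmod_val z, map_pow f₂, h₂]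
  exact hpow _ x

theorem monoidHom_injective_of_relations
    {K : Type*} [Group K] {g h : K} (hg : g ^ 9 = 1) (hg3 : g ^ 3 ≠ 1) (hh : h ^ 3 = 1)
    (hr : h * g = g ^ 4 * h)
    {f : Multiplicative (ZMod 9) ⋊[φ] Multiplicative (ZMod 3) →* K}
    (h₁ : f (SemidirectProduct.inl (ofAdd 1)) = g)
    (h₂ : f (SemidirectProduct.inr (ofAdd 1)) = h) : Function.Injective f := by
  rw [injective_iff_map_eq_one]
  intro x hx
  rw [semidirectProduct_zmod_eq_pow_mul_pow x, map_mul, map_pow, map_pow, h₁, h₂] at hx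
  obtain ⟨hi, hj⟩ := eq_one_of_pow_mul_pow_eq_one hg hg3 hh hr hx
  have hl : x.left.toAdd.val = 0 := Nat.eq_zero_of_dvd_of_lt hi (ZMod.val_lt _)
  have hv : x.right.toAdd.val = 0 := Nat.eq_zero_of_dvd_of_lt hj (ZMod.val_lt _)
  rw [semidirectProduct_zmod_eq_pow_mul_pow x, hl, hv, pow_zero, pow_zero, mul_one]

theorem toAdd_action_eq
    (hφ : ∀ x : ZMod 9, φ (ofAdd (1 : ZMod 3)) (ofAdd x) = ofAdd (4 * x))
    (y : Multiplicative (ZMod 3)) (x : Multiplicative (ZMod 9)) :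
    (φ y x).toAdd = 4 ^ y.toAdd.val * x.toAdd := by
  have hpow : ∀ k : ℕ, (φ (ofAdd 1 ^ k) x).toAdd = 4 ^ k * x.toAdd := by
    intro k
    induction k with
    | zero => simp
    | succ k ih =>
      rw [pow_succ', map_mul, MulAut.mul_apply, ← ofAdd_toAdd (φ (ofAdd 1 ^ k) x), hφ, ih,
        toAdd_ofAdd, pow_succ']
      ring
  conv_lhs => rw [← ofAdd_one_pow_zmod_val y]
  exact hpow _

theorem pow_three_eq_inl
    (hφ : ∀ x : ZMod 9, φ (ofAdd (1 : ZMod 3)) (ofAdd x) = ofAdd (4 * x))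
    (x : Multiplicative (ZMod 9) ⋊[φ] Multiplicative (ZMod 3)) :
    x ^ 3 = SemidirectProduct.inl (ofAdd (3 * x.left.toAdd)) := by
  have key : ∀ (u : ZMod 9) (v : ZMod 3),
      u + 4 ^ v.val * u + 4 ^ v.val * (4 ^ v.val * u) = 3 * u ∧ v + v + v = 0 := by decide
  have h := key x.left.toAdd x.right.toAdd
  rw [pow_succ, pow_two]
  refine SemidirectProduct.ext (toAdd.injective (Eq.trans ?_ h.1))
    (toAdd.injective (Eq.trans ?_ h.2))
  · simp [toAdd_action_eq hφ]
  · simp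

theorem pow_nine_eq_one
    (hφ : ∀ x : ZMod 9, φ (ofAdd (1 : ZMod 3)) (ofAdd x) = ofAdd (4 * x))
    (x : Multiplicative (ZMod 9) ⋊[φ] Multiplicative (ZMod 3)) : x ^ 9 = 1 := by
  have key : ∀ u : ZMod 9, 3 * (3 * u) = 0 := by decide
  rw [pow_mul x 3 3, pow_three_eq_inl hφ, pow_three_eq_inl hφ,
    SemidirectProduct.left_inl, toAdd_ofAdd, key, ofAdd_zero, map_one]

theorem pow_three_eq_one_iff
    (hφ : ∀ x : ZMod 9, φ (ofAdd (1 : ZMod 3)) (ofAdd x) = ofAdd (4 * x))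
    (x : Multiplicative (ZMod 9) ⋊[φ] Multiplicative (ZMod 3)) :
    x ^ 3 = 1 ↔ 3 * x.left.toAdd = 0 := by
  rw [pow_three_eq_inl hφ, map_eq_one_iff _ SemidirectProduct.inl_injective, ofAdd_eq_one]

theorem relations_iff
    (hφ : ∀ x : ZMod 9, φ (ofAdd (1 : ZMod 3)) (ofAdd x) = ofAdd (4 * x))
    (g h : Multiplicative (ZMod 9) ⋊[φ] Multiplicative (ZMod 3)) :
    (g ^ 3 ≠ 1 ∧ h ^ 3 = 1 ∧ h * g = g ^ 4 * h) ↔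
      3 * g.left.toAdd ≠ 0 ∧ 3 * h.left.toAdd = 0 ∧ h.right.toAdd = 1 := by
  have key : ∀ (u w : ZMod 9), 3 * u ≠ 0 → 3 * w = 0 → ∀ v z : ZMod 3,
      (w + 4 ^ z.val * u = 3 * u + (u + 4 ^ v.val * w) ↔ z = 1) := by decide +kernel
  rw [pow_three_eq_one_iff hφ, ne_eq, pow_three_eq_one_iff hφ]
  refine and_congr_right fun hg ↦ and_congr_right fun hh ↦ ?_
  rw [← key _ _ hg hh g.right.toAdd h.right.toAdd, pow_succ, pow_three_eq_inl hφ, mul_assoc,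
    SemidirectProduct.ext_iff]
  have hright : (h * g).right =
      (SemidirectProduct.inl (ofAdd (3 * g.left.toAdd)) * (g * h)).right := by
    simp [mul_comm]
  rw [and_iff_left hright, ← toAdd.injective.eq_iff]
  simp [toAdd_action_eq hφ]

/-- The pairs of images of the two standard generators under an automorphism, in coordinates. -/
theorem card_generator_images :
    Nat.card {p : (Multiplicative (ZMod 9) ⋊[φ] Multiplicative (ZMod 3)) ×
        (Multiplicative (ZMod 9) ⋊[φ] Multiplicative (ZMod 3)) //
      3 * p.1.left.toAdd ≠ 0 ∧ 3 * p.2.left.toAdd = 0 ∧ p.2.right.toAdd = 1} = 54 := by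
  let e : {p : (Multiplicative (ZMod 9) ⋊[φ] Multiplicative (ZMod 3)) ×
        (Multiplicative (ZMod 9) ⋊[φ] Multiplicative (ZMod 3)) //
      3 * p.1.left.toAdd ≠ 0 ∧ 3 * p.2.left.toAdd = 0 ∧ p.2.right.toAdd = 1} ≃
      {u : ZMod 9 // 3 * u ≠ 0} × ZMod 3 × {w : ZMod 9 // 3 * w = 0} :=
    { toFun := fun p ↦ (⟨p.1.1.left.toAdd, p.2.1⟩, p.1.1.right.toAdd,
        ⟨p.1.2.left.toAdd, p.2.2.1⟩)
      invFun := fun q ↦ ⟨(⟨ofAdd q.1.1, ofAdd q.2.1⟩, ⟨ofAdd q.2.2.1, ofAdd 1⟩),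
        q.1.2, q.2.2.2, rfl⟩
      left_inv := by
        rintro ⟨⟨⟨u, v⟩, ⟨w, z⟩⟩, h1, h2, h3⟩
        obtain rfl : z = ofAdd 1 := h3
        rfl
      right_inv := fun _ ↦ rfl }
  have hu : Fintype.card {u : ZMod 9 // 3 * u ≠ 0} = 6 := by decide
  have hw : Fintype.card {w : ZMod 9 // 3 * w = 0} = 3 := by decide
  rw [Nat.card_congr e, Nat.card_prod, Nat.card_prod, Nat.card_eq_fintype_card,
    Nat.card_eq_fintype_card, Nat.card_eq_fintype_card, hu, hw, ZMod.card]

end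

/-- Let `G = ℤ/9 ⋊_φ ℤ/3` be the nonabelian group of order 27 of exponent 9, where the
generator `1` of `ℤ/3` acts on `ℤ/9` as `x ↦ 4x`.  Then `|Aut(G)| = 54`. -/
theorem card_mulAut_nonabelian_27_exponent_9
    (φ : Multiplicative (ZMod 3) →* MulAut (Multiplicative (ZMod 9)))
    (hφ : ∀ x : ZMod 9,
      φ (Multiplicative.ofAdd (1 : ZMod 3)) (Multiplicative.ofAdd x) =
        Multiplicative.ofAdd (4 * x)) :
    Nat.card (MulAut (Multiplicative (ZMod 9) ⋊[φ] Multiplicative (ZMod 3))) = 54 := by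
  let G := Multiplicative (ZMod 9) ⋊[φ] Multiplicative (ZMod 3)
  let a : G := SemidirectProduct.inl (ofAdd 1)
  let b : G := SemidirectProduct.inr (ofAdd 1)
  have hab : a ^ 3 ≠ 1 ∧ b ^ 3 = 1 ∧ b * a = a ^ 4 * b := by
    rw [relations_iff hφ]
    simp only [a, b, SemidirectProduct.left_inl, SemidirectProduct.left_inr,
      SemidirectProduct.right_inr, toAdd_ofAdd, toAdd_one]
    decide
  let F (f : MulAut G) : {p : G × G //
      3 * p.1.left.toAdd ≠ 0 ∧ 3 * p.2.left.toAdd = 0 ∧ p.2.right.toAdd = 1} :=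
    ⟨(f a, f b), (relations_iff hφ _ _).1 (by
      simpa only [← map_pow, ← map_mul, ne_eq, EmbeddingLike.map_eq_one_iff,
        EmbeddingLike.apply_eq_iff_eq] using hab)⟩
  have hF : Function.Bijective F := by
    constructor
    · intro f f' hff
      have h := Subtype.ext_iff.1 hff
      have ha : f a = f' a := congrArg Prod.fst h
      have hb : f b = f' b := congrArg Prod.snd h
      ext1 x
      rw [semidirectProduct_zmod_eq_pow_mul_pow x, map_mul, map_mul, map_pow, map_pow, map_pow,
        map_pow, ha, hb]
    · rintro ⟨⟨g, h⟩, hgh⟩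
      obtain ⟨hg3, hh, hr⟩ := (relations_iff hφ g h).2 hgh
      have hg := pow_nine_eq_one hφ g
      obtain ⟨f, h₁, h₂⟩ := exists_monoidHom_of_relations hφ hg hh hr
      have hinj := monoidHom_injective_of_relations hg hg3 hh hr h₁ h₂
      have : Finite G := Finite.of_equiv _ SemidirectProduct.equivProd.symm
      exact ⟨MulEquiv.ofBijective f (Finite.injective_iff_bijective.1 hinj),
        Subtype.ext (Prod.ext h₁ h₂)⟩
  exact (Nat.card_congr (Equiv.ofBijective F hF)).trans card_generator_images
end
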